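/- For every natural number n ≥ 3 there exists a Ważewski dendrite of order n, i.e. a nonempty, compact, connected, locally connected metrizable topological space X containing no subspace homeomorphic to the circle, such that every point of X has order 1, 2 or n (the order of a point p being the number of connected components of X \ {p}) and such that every arc of X (subspace homeomorphic to the unit interval [0,1]) contains a point of order n. -/

import Mathlib

open Topology

/-- The set of connected components of a subset `S` of `X`. -/
def setComponents (X : Type*) [TopologicalSpace X] (S : Set X) : Set (Set X) :=
  {C | ∃ x ∈ S, C = connectedComponentIn S x}

/-- The order of a point `p` of `X`: the number of connected components of `X \ {p}`. -/
noncomputable def ptOrder (X : Type*) [TopologicalSpace X] (p : X) : ℕ :=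
  (setComponents X {p}ᶜ).ncard

/-- A dendrite: a nonempty, compact, connected, locally connected metrizable space
containing no subspace homeomorphic to the circle. -/
def IsDendrite (X : Type*) [TopologicalSpace X] : Prop :=
  Nonempty X ∧ CompactSpace X ∧ ConnectedSpace X ∧ LocallyConnectedSpace X ∧
    TopologicalSpace.MetrizableSpace X ∧
    ∀ S : Set X, IsEmpty (S ≃ₜ Circle)

/-- A Ważewski dendrite of order `n`: a dendrite all of whose points have order `1`, `2`
or `n`, and every arc (subspace homeomorphic to `[0,1]`) contains a point of order `n`. -/
def IsWazewskiDendrite (n : ℕ) (X : Type*) [TopologicalSpace X] : Prop :=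
  IsDendrite X ∧
  (∀ p : X, ptOrder X p = 1 ∨ ptOrder X p = 2 ∨ ptOrder X p = n) ∧
  ∀ A : Set X, Nonempty (A ≃ₜ unitInterval) → ∃ p ∈ A, ptOrder X p = n

/-- The group structure on self-homeomorphisms of `X`, with composition as product. -/
instance Homeomorph.instGroupSelf (X : Type*) [TopologicalSpace X] : Group (X ≃ₜ X) where
  mul f g := g.trans f
  one := Homeomorph.refl X
  inv := Homeomorph.symm
  mul_assoc _ _ _ := rfl
  one_mul _ := Homeomorph.ext fun _ => rfl
  mul_one _ := Homeomorph.ext fun _ => rfl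
  inv_mul_cancel := Homeomorph.self_trans_symm

/-- The compact-open topology on the group of self-homeomorphisms of `X` (for compact
metric `X`, this is the topology of uniform convergence). -/
instance Homeomorph.instTopSelf (X : Type*) [TopologicalSpace X] :
    TopologicalSpace (X ≃ₜ X) :=
  TopologicalSpace.induced (fun h : X ≃ₜ X => (h : C(X, X))) ContinuousMap.compactOpen

namespace Waz

variable {m : ℕ}

/-- Sequences over an alphabet with `m + 3` letters. -/
abbrev Sq (m : ℕ) : Type := ℕ → Fin (m + 3)

/-- Prepend a letter. -/
def cons (i : Fin (m + 3)) (x : Sq m) : Sq m := fun k => Nat.casesOn k i x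

/-- The shift. -/
def sh (x : Sq m) : Sq m := fun k => x (k + 1)

@[simp] theorem cons_zero (i : Fin (m + 3)) (x : Sq m) : cons i x 0 = i := rfl
@[simp] theorem cons_succ (i : Fin (m + 3)) (x : Sq m) (k : ℕ) : cons i x (k + 1) = x k := rfl
@[simp] theorem sh_cons (i : Fin (m + 3)) (x : Sq m) : sh (cons i x) = x := rfl
@[simp] theorem sh_apply (x : Sq m) (k : ℕ) : sh x k = x (k + 1) := rfl

theorem cons_sh (x : Sq m) : cons (x 0) (sh x) = x := by
  funext k; cases k <;> rfl

theorem cons_inj {i j : Fin (m + 3)} {x y : Sq m} : cons i x = cons j y ↔ i = j ∧ x = y := by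
  constructor
  · intro h
    exact ⟨congrFun h 0, congrArg sh h⟩
  · rintro ⟨rfl, rfl⟩; rfl

/-- The constant sequence `111…`. -/
def one (m : ℕ) : Sq m := fun _ => 1

/-- The kneading sequence `0111…`. -/
def aa (m : ℕ) : Sq m := cons 0 (one m)

theorem one_eq : one m = cons 1 (one m) := by
  funext k; cases k <;> rfl

theorem zero_ne_one' : (0 : Fin (m + 3)) ≠ 1 := by
  intro h
  have := congrArg Fin.val h
  simp at this

theorem one_ne_aa : one m ≠ aa m := fun h => zero_ne_one' (congrFun h 0).symm

/-- The representatives of the branch point with address `w`. -/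
def B : List (Fin (m + 3)) → Fin (m + 3) → Sq m
  | [], i => cons i (aa m)
  | j :: w, i => cons j (B w i)

theorem B_val (w : List (Fin (m + 3))) (i : Fin (m + 3)) : B w i (w.length + 1) = 0 := by
  induction w with
  | nil => rfl
  | cons j w ih => simpa [B] using ih

theorem aa_ne_B (w : List (Fin (m + 3))) (i : Fin (m + 3)) : aa m ≠ B w i := by
  intro h
  have h1 := B_val w i
  rw [← h] at h1
  exact zero_ne_one' h1.symm

theorem one_ne_B (w : List (Fin (m + 3))) (i : Fin (m + 3)) : one m ≠ B w i := by
  intro h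
  have h1 := B_val w i
  rw [← h] at h1
  exact zero_ne_one' h1.symm

theorem B_inj {w w' : List (Fin (m + 3))} {i j : Fin (m + 3)} (h : B w i = B w' j) :
    w = w' ∧ i = j := by
  induction w generalizing w' with
  | nil =>
    cases w' with
    | nil => exact ⟨rfl, (cons_inj.1 h).1⟩
    | cons k w' => exact absurd (cons_inj.1 h).2 (aa_ne_B _ _)
  | cons l w ih =>
    cases w' with
    | nil => exact absurd (cons_inj.1 h).2.symm (aa_ne_B _ _)
    | cons k w' =>
      obtain ⟨h1, h2⟩ := cons_inj.1 h
      obtain ⟨h3, h4⟩ := ih h2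
      exact ⟨by rw [h1, h3], h4⟩

/-- The gluing relation. -/
def R (x y : Sq m) : Prop := x = y ∨ ∃ w i j, x = B w i ∧ y = B w j

theorem R_symm {x y : Sq m} (h : R x y) : R y x := by
  rcases h with rfl | ⟨w, i, j, h1, h2⟩
  · exact Or.inl rfl
  · exact Or.inr ⟨w, j, i, h2, h1⟩

theorem R_trans {x y z : Sq m} (h : R x y) (h' : R y z) : R x z := by
  rcases h with rfl | ⟨w, i, j, h1, h2⟩
  · exact h'
  rcases h' with rfl | ⟨w', i', j', h1', h2'⟩
  · exact Or.inr ⟨w, i, j, h1, h2⟩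
  · obtain ⟨rfl, -⟩ := B_inj (h2.symm.trans h1')
    exact Or.inr ⟨w, i, j', h1, h2'⟩

theorem R_cons (i : Fin (m + 3)) {x y : Sq m} (h : R x y) : R (cons i x) (cons i y) := by
  rcases h with rfl | ⟨w, k, j, rfl, rfl⟩
  · exact Or.inl rfl
  · exact Or.inr ⟨i :: w, k, j, rfl, rfl⟩

/-- The setoid of the gluing relation. -/
def std (m : ℕ) : Setoid (Sq m) := ⟨R, fun _ => Or.inl rfl, R_symm, R_trans⟩

/-- The dendrite. -/
def X (m : ℕ) : Type := Quotient (std m)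

instance : TopologicalSpace (X m) := inferInstanceAs (TopologicalSpace (Quotient (std m)))

/-- The quotient map. -/
def q (x : Sq m) : X m := Quotient.mk (std m) x

theorem q_quot : IsQuotientMap (q : Sq m → X m) := isQuotientMap_quot_mk

theorem q_cont : Continuous (q : Sq m → X m) := q_quot.continuous

theorem q_surj (p : X m) : ∃ x, q x = p := q_quot.surjective p

theorem q_eq {x y : Sq m} : q x = q y ↔ R x y := Quotient.eq (r := std m)

instance : CompactSpace (X m) := inferInstanceAs (CompactSpace (Quotient (std m)))

instance : Nonempty (X m) := ⟨q (aa m)⟩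

/-- The branch point with address `w`. -/
def b (w : List (Fin (m + 3))) : X m := q (B w 0)

theorem q_B (w : List (Fin (m + 3))) (i : Fin (m + 3)) : q (B w i) = b w :=
  q_eq.2 (Or.inr ⟨w, i, 0, rfl, rfl⟩)

theorem q_eq_b {x : Sq m} {w : List (Fin (m + 3))} : q x = b w ↔ ∃ i, x = B w i := by
  constructor
  · intro h
    rcases q_eq.1 h with h | ⟨w', i, j, h1, h2⟩
    · exact ⟨0, h⟩
    · obtain ⟨rfl, -⟩ := B_inj h2
      exact ⟨i, h1⟩
  · rintro ⟨i, rfl⟩; exact q_B w i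

theorem q_cons_eq_b {x : Sq m} {w : List (Fin (m + 3))} {i j : Fin (m + 3)} :
    q (cons i x) = b (j :: w) ↔ i = j ∧ q x = b w := by
  simp only [q_eq_b, B, cons_inj, exists_and_left]

theorem e_ne_b (w : List (Fin (m + 3))) : q (aa m) ≠ b w := by
  intro h
  obtain ⟨i, hi⟩ := q_eq_b.1 h
  exact aa_ne_B _ _ hi

/-- The side of the branch point with address `w` on which a sequence lies. -/
def s : List (Fin (m + 3)) → Sq m → Fin (m + 3)
  | [], x => x 0
  | i :: w, x => if x 0 = i then s w (sh x) else s w (aa m)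

theorem s_cons (i j : Fin (m + 3)) (w : List (Fin (m + 3))) (x : Sq m) :
    s (i :: w) (cons j x) = if j = i then s w x else s w (aa m) := rfl

theorem B_nil (i : Fin (m + 3)) : B [] i = cons i (aa m) := rfl

theorem B_cons (i j : Fin (m + 3)) (w : List (Fin (m + 3))) :
    B (j :: w) i = cons j (B w i) := rfl

theorem s_B {w w' : List (Fin (m + 3))} (h : w' ≠ w) (i j : Fin (m + 3)) :
    s w (B w' i) = s w (B w' j) := by
  induction w generalizing w' with
  | nil =>
    cases w' with
    | nil => exact absurd rfl h
    | cons k w' => rfl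
  | cons l w ih =>
    cases w' with
    | nil => rw [B_nil, B_nil, s_cons, s_cons, ite_self, ite_self]
    | cons k w' =>
      rw [B_cons, B_cons, s_cons, s_cons]
      by_cases hk : k = l
      · subst hk
        have h2 : w' ≠ w := fun h' => h (by rw [h'])
        rw [if_pos rfl, if_pos rfl]
        exact ih h2
      · rw [if_neg hk, if_neg hk]

theorem s_congr {w : List (Fin (m + 3))} {x y : Sq m} (h : q x = q y) (hx : q x ≠ b w) :
    s w x = s w y := by
  rcases q_eq.1 h with rfl | ⟨w', i, j, rfl, rfl⟩
  · rfl
  · apply s_B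
    rintro rfl
    exact hx (q_B _ _)

theorem sh_cont : Continuous (sh : Sq m → Sq m) :=
  continuous_pi fun k => continuous_apply (k + 1)

theorem cons_cont (i : Fin (m + 3)) : Continuous (cons i : Sq m → Sq m) := by
  refine continuous_pi fun k => ?_
  cases k with
  | zero => exact continuous_const
  | succ k => exact continuous_apply k

theorem s_cont (w : List (Fin (m + 3))) : Continuous (s w) := by
  induction w with
  | nil => exact continuous_apply 0
  | cons i w ih =>
    have h1 : Continuous (fun u : Fin (m + 3) × Fin (m + 3) => if u.1 = i then u.2 else s w (aa m)) :=
      continuous_of_discreteTopology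
    exact h1.comp ((continuous_apply 0).prodMk (ih.comp sh_cont))

/-- The side function on the dendrite. -/
noncomputable def sX (w : List (Fin (m + 3))) (p : X m) : Fin (m + 3) :=
  s w (q_surj p).choose

theorem sX_q {w : List (Fin (m + 3))} {x : Sq m} (hx : q x ≠ b w) : sX w (q x) = s w x :=
  (s_congr (q_surj (q x)).choose_spec.symm hx).symm

/-- The sides of a branch point. -/
def U (w : List (Fin (m + 3))) (l : Fin (m + 3)) : Set (X m) := {p | p ≠ b w ∧ sX w p = l}

theorem mem_U {w : List (Fin (m + 3))} {l : Fin (m + 3)} {x : Sq m} :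
    q x ∈ U w l ↔ q x ≠ b w ∧ s w x = l := by
  constructor
  · rintro ⟨h1, h2⟩
    exact ⟨h1, by rw [← h2, sX_q h1]⟩
  · rintro ⟨h1, h2⟩
    exact ⟨h1, by rw [← h2, sX_q h1]⟩

theorem U_open (w : List (Fin (m + 3))) (l : Fin (m + 3)) : IsOpen (U w l) := by
  rw [← q_quot.isOpen_preimage]
  have h1 : q ⁻¹' U w l = (Set.range (B w))ᶜ ∩ s w ⁻¹' {l} := by
    ext x
    simp only [Set.mem_preimage, mem_U, ne_eq, q_eq_b, Set.mem_inter_iff, Set.mem_compl_iff,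
      Set.mem_range, Set.mem_singleton_iff, eq_comm (b := x)]
  rw [h1]
  exact (Set.finite_range _).isClosed.isOpen_compl.inter ((isOpen_discrete _).preimage (s_cont w))

theorem U_disj (w : List (Fin (m + 3))) {l l' : Fin (m + 3)} (h : l ≠ l') :
    Disjoint (U w l) (U w l') := by
  rw [Set.disjoint_left]
  rintro p ⟨-, h1⟩ ⟨-, h2⟩
  exact h (h1.symm.trans h2)

/-- Two points are separated by a branch point. -/
def D (p p' : X m) : Prop := ∃ w, p ≠ b w ∧ p' ≠ b w ∧ sX w p ≠ sX w p'

theorem D_symm {p p' : X m} (h : D p p') : D p' p := by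
  obtain ⟨w, h1, h2, h3⟩ := h
  exact ⟨w, h2, h1, h3.symm⟩

theorem D_cons {i : Fin (m + 3)} {x y : Sq m} (h : D (q x) (q y)) :
    D (q (cons i x)) (q (cons i y)) := by
  obtain ⟨w, h1, h2, h3⟩ := h
  have h1' : q (cons i x) ≠ b (i :: w) := by simpa [q_cons_eq_b] using h1
  have h2' : q (cons i y) ≠ b (i :: w) := by simpa [q_cons_eq_b] using h2
  refine ⟨i :: w, h1', h2', ?_⟩
  rw [sX_q h1', sX_q h2']
  rw [sX_q h1, sX_q h2] at h3
  simpa [s] using h3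

theorem ne_nil {i : Fin (m + 3)} {x : Sq m} (h : x ≠ aa m) : q (cons i x) ≠ b [] := by
  rw [ne_eq, q_eq_b]
  rintro ⟨j, hj⟩
  exact h (cons_inj.1 hj).2

theorem D_nil {i j : Fin (m + 3)} {x y : Sq m} (hij : i ≠ j) (hx : x ≠ aa m) (hy : y ≠ aa m) :
    D (q (cons i x)) (q (cons j y)) := by
  refine ⟨[], ne_nil hx, ne_nil hy, ?_⟩
  rw [sX_q (ne_nil hx), sX_q (ne_nil hy)]
  exact hij

theorem q_cons_aa (i j : Fin (m + 3)) : q (cons i (aa m)) = q (cons j (aa m)) :=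
  (q_B [] i).trans (q_B [] j).symm

theorem D_one_aa : D (q (one m)) (q (aa m)) := by
  rw [one_eq]
  exact D_nil zero_ne_one'.symm one_ne_aa one_ne_aa

theorem D_one (k : ℕ) (y : Sq m) (h : ∀ j < k, y j = 1) (hk : y k ≠ 1) : D (q (one m)) (q y) := by
  induction k generalizing y with
  | zero =>
    rw [← cons_sh y]
    by_cases hy : sh y = aa m
    · rw [hy, q_cons_aa _ 1, one_eq]
      exact D_cons D_one_aa
    · rw [one_eq]
      exact D_nil hk.symm one_ne_aa hy
  | succ k ih =>
    rw [← cons_sh y, h 0 (Nat.succ_pos _), one_eq]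
    exact D_cons (ih (sh y) (fun j hj => h (j + 1) (by omega)) hk)

theorem D_one' (y : Sq m) (h : y ≠ one m) : D (q (one m)) (q y) := by
  classical
  have h1 : ∃ k, y k ≠ 1 := by
    by_contra! h2
    exact h (funext h2)
  exact D_one (Nat.find h1) y (fun j hj => not_not.1 (Nat.find_min h1 hj)) (Nat.find_spec h1)

theorem D_aa (y : Sq m) (h : y ≠ aa m) : D (q (aa m)) (q y) := by
  rw [← cons_sh y]
  by_cases h0 : y 0 = 0
  · rw [h0]
    refine D_cons (D_one' _ fun h1 => h ?_)
    rw [← cons_sh y, h0, h1]; rfl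
  · by_cases h1 : sh y = aa m
    · rw [h1, q_cons_aa _ 0]
      exact D_cons D_one_aa
    · exact D_nil (Ne.symm h0) one_ne_aa h1

theorem D_main (k : ℕ) (x y : Sq m) (h : ∀ j < k, x j = y j) (hk : x k ≠ y k) (hR : q x ≠ q y) :
    D (q x) (q y) := by
  induction k generalizing x y with
  | zero =>
    rw [← cons_sh x, ← cons_sh y] at hR ⊢
    by_cases hx : sh x = aa m
    · by_cases hy : sh y = aa m
      · rw [hx, hy] at hR
        exact absurd (q_cons_aa _ _) hR
      · rw [hx, q_cons_aa _ (y 0)]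
        exact D_cons (D_aa _ hy)
    · by_cases hy : sh y = aa m
      · rw [hy, q_cons_aa _ (x 0)]
        exact D_cons (D_symm (D_aa _ hx))
      · exact D_nil hk hx hy
  | succ k ih =>
    rw [← cons_sh x, ← cons_sh y, h 0 (Nat.succ_pos _)] at hR ⊢
    refine D_cons (ih _ _ (fun j hj => h (j + 1) (by omega)) hk fun h1 => hR ?_)
    exact q_eq.2 (R_cons _ (q_eq.1 h1))

theorem exists_first {x y : Sq m} (h : x ≠ y) : ∃ k, (∀ j < k, x j = y j) ∧ x k ≠ y k := by
  classical
  have h1 : ∃ k, x k ≠ y k := by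
    by_contra! h2
    exact h (funext h2)
  exact ⟨Nat.find h1, fun j hj => not_not.1 (Nat.find_min h1 hj), Nat.find_spec h1⟩

theorem D_of_ne {p p' : X m} (h : p ≠ p') : D p p' := by
  obtain ⟨x, rfl⟩ := q_surj p
  obtain ⟨y, rfl⟩ := q_surj p'
  obtain ⟨k, h1, h2⟩ := exists_first (fun h' : x = y => h (by rw [h']))
  exact D_main k x y h1 h2 h

instance : T2Space (X m) := by
  refine ⟨fun p p' h => ?_⟩
  obtain ⟨w, h1, h2, h3⟩ := D_of_ne h
  exact ⟨U w (sX w p), U w (sX w p'), U_open _ _, U_open _ _, ⟨h1, rfl⟩, ⟨h2, rfl⟩, U_disj _ h3⟩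

theorem top_eq {Y : Type*} (t t' : TopologicalSpace Y) (hc : @CompactSpace Y t)
    (ht : @T2Space Y t') (hle : t ≤ t') : t = t' := by
  refine le_antisymm hle ?_
  have hc' : @Continuous Y Y t t' id := continuous_id_iff_le.2 hle
  have := @Continuous.isClosedMap Y Y t t' hc ht id hc'
  intro V hV
  have h1 := this Vᶜ (@IsOpen.isClosed_compl Y t V hV)
  rw [Set.image_id] at h1
  exact (@isClosed_compl_iff Y t' V).1 h1

theorem second : SecondCountableTopology (X m) := by
  have hG := Set.countable_range fun u : List (Fin (m + 3)) × Fin (m + 3) => U u.1 u.2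
  refine ⟨⟨_, hG, top_eq _ _ inferInstance ?_ ?_⟩⟩
  · refine @T2Space.mk _ (_) fun p p' h => ?_
    obtain ⟨w, h1, h2, h3⟩ := D_of_ne h
    refine ⟨U w (sX w p), U w (sX w p'), ?_, ?_, ⟨h1, rfl⟩, ⟨h2, rfl⟩, U_disj _ h3⟩
    · exact TopologicalSpace.isOpen_generateFrom_of_mem ⟨(_, _), rfl⟩
    · exact TopologicalSpace.isOpen_generateFrom_of_mem ⟨(_, _), rfl⟩
  · refine le_generateFrom ?_
    rintro _ ⟨u, rfl⟩
    exact U_open _ _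

instance : TopologicalSpace.MetrizableSpace (X m) := by
  have := second (m := m)
  exact TopologicalSpace.metrizableSpace_of_t3_secondCountable _

/-- The first `k` letters of `x`. -/
def pre : ℕ → Sq m → List (Fin (m + 3))
  | 0, _ => []
  | k + 1, x => x 0 :: pre k (sh x)

theorem B_pre_lt (k : ℕ) (x : Sq m) (i : Fin (m + 3)) (j : ℕ) (h : j < k) :
    B (pre k x) i j = x j := by
  induction k generalizing x j with
  | zero => omega
  | succ k ih =>
    cases j with
    | zero => rfl
    | succ j => exact ih (sh x) j (by omega)

theorem B_pre_eq (k : ℕ) (x : Sq m) (i : Fin (m + 3)) : B (pre k x) i k = i := by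
  induction k generalizing x with
  | zero => rfl
  | succ k ih => exact ih (sh x)

theorem B_pre_gt (k : ℕ) (x : Sq m) (i : Fin (m + 3)) (j : ℕ) :
    B (pre k x) i (k + j + 1) = aa m j := by
  induction k generalizing x with
  | zero => rw [Nat.zero_add]; rfl
  | succ k ih =>
    rw [show k + 1 + j + 1 = (k + j + 1) + 1 by omega]
    exact ih (sh x)

theorem exists_cyl {V : Set (Sq m)} (hV : IsOpen V) {x : Sq m} (hx : x ∈ V) :
    ∃ k, PiNat.cylinder x k ⊆ V := by
  obtain ⟨_, ⟨y, k, rfl⟩, h1, h2⟩ :=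
    (PiNat.isTopologicalBasis_cylinders (fun _ : ℕ => Fin (m + 3))).exists_subset_of_mem_open hx hV
  exact ⟨k, by rwa [PiNat.mem_cylinder_iff_eq.1 h1]⟩

theorem clopen_unif {T : Set (Sq m)} (hT : IsClopen T) :
    ∃ k, ∀ x y : Sq m, (∀ j < k, y j = x j) → (y ∈ T ↔ x ∈ T) := by
  have h1 : ∃ k, ∀ x ∈ (Set.univ : Set (Sq m)), ∀ y, (∀ j < k, y j = x j) → (y ∈ T ↔ x ∈ T) := by
    refine isCompact_univ.induction_on (p := fun A => ∃ k, ∀ x ∈ A, ∀ y,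
      (∀ j < k, y j = x j) → (y ∈ T ↔ x ∈ T)) ⟨0, by simp⟩ ?_ ?_ ?_
    · rintro s t hst ⟨k, hk⟩
      exact ⟨k, fun x hx => hk x (hst hx)⟩
    · rintro s t ⟨k, hk⟩ ⟨l, hl⟩
      refine ⟨max k l, ?_⟩
      rintro x (hx | hx) y hy
      · exact hk x hx y fun j hj => hy j (lt_max_of_lt_left hj)
      · exact hl x hx y fun j hj => hy j (lt_max_of_lt_right hj)
    · intro x _
      by_cases hx : x ∈ T
      · obtain ⟨k, hk⟩ := exists_cyl hT.isOpen hx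
        refine ⟨PiNat.cylinder x k, mem_nhdsWithin_of_mem_nhds
          ((PiNat.isOpen_cylinder _ x k).mem_nhds (PiNat.self_mem_cylinder x k)), k, ?_⟩
        intro z hz y hy
        have hy' : y ∈ PiNat.cylinder x k := fun j hj => (hy j hj).trans (hz j hj)
        exact iff_of_true (hk hy') (hk hz)
      · obtain ⟨k, hk⟩ := exists_cyl hT.compl.isOpen hx
        refine ⟨PiNat.cylinder x k, mem_nhdsWithin_of_mem_nhds
          ((PiNat.isOpen_cylinder _ x k).mem_nhds (PiNat.self_mem_cylinder x k)), k, ?_⟩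
        intro z hz y hy
        have hy' : y ∈ PiNat.cylinder x k := fun j hj => (hy j hj).trans (hz j hj)
        exact iff_of_false (hk hy') (hk hz)
  obtain ⟨k, hk⟩ := h1
  exact ⟨k, fun x => hk x trivial⟩

theorem clopen_triv {S : Set (X m)} (k : ℕ)
    (h : ∀ x y : Sq m, (∀ j < k, y j = x j) → (q y ∈ S ↔ q x ∈ S)) (x y : Sq m) :
    q x ∈ S ↔ q y ∈ S := by
  induction k with
  | zero => exact h y x (by simp)
  | succ k ih =>
    refine ih fun x y hxy => ?_
    have h1 : q (B (pre k x) (x k)) ∈ S ↔ q x ∈ S := by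
      refine h _ _ fun j hj => ?_
      rcases Nat.lt_succ_iff_lt_or_eq.1 hj with hj | rfl
      · exact B_pre_lt _ _ _ _ hj
      · exact B_pre_eq _ _ _
    have h2 : q (B (pre k x) (y k)) ∈ S ↔ q y ∈ S := by
      refine h _ _ fun j hj => ?_
      rcases Nat.lt_succ_iff_lt_or_eq.1 hj with hj | rfl
      · exact (B_pre_lt _ _ _ _ hj).trans (hxy j hj).symm
      · exact B_pre_eq _ _ _
    rw [← h1, ← h2, q_B, q_B]

instance : PreconnectedSpace (X m) := by
  refine preconnectedSpace_iff_clopen.2 fun S hS => ?_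
  obtain ⟨k, hk⟩ := clopen_unif (hS.preimage q_cont)
  have h := clopen_triv k hk
  by_cases h0 : q (aa m) ∈ S
  · right
    refine Set.eq_univ_of_forall fun p => ?_
    obtain ⟨x, rfl⟩ := q_surj p
    exact (h _ _).1 h0
  · left
    refine Set.eq_empty_of_forall_notMem fun p hp => ?_
    obtain ⟨x, rfl⟩ := q_surj p
    exact h0 ((h _ _).1 hp)

instance : ConnectedSpace (X m) := ⟨inferInstance⟩

/-- The similarities. -/
def F (i : Fin (m + 3)) : X m → X m :=
  Quotient.lift (s := std m) (fun x => q (cons i x)) fun _ _ h => q_eq.2 (R_cons i h)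

@[simp] theorem F_q (i : Fin (m + 3)) (x : Sq m) : F i (q x) = q (cons i x) := rfl

theorem F_cont (i : Fin (m + 3)) : Continuous (F i : X m → X m) :=
  q_quot.continuous_iff.2 (q_cont.comp (cons_cont i))

theorem cyl_conn (k : ℕ) (x : Sq m) : IsPreconnected (q '' PiNat.cylinder x k) := by
  induction k generalizing x with
  | zero =>
    rw [PiNat.cylinder_zero, Set.image_univ, q_quot.surjective.range_eq]
    exact isPreconnected_univ
  | succ k ih =>
    have h1 : q '' PiNat.cylinder x (k + 1) = F (x 0) '' (q '' PiNat.cylinder (sh x) k) := by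
      ext p
      constructor
      · rintro ⟨y, hy, rfl⟩
        refine ⟨_, ⟨sh y, fun j hj => hy (j + 1) (by omega), rfl⟩, ?_⟩
        rw [F_q, ← hy 0 (by omega), cons_sh]
      · rintro ⟨_, ⟨y, hy, rfl⟩, rfl⟩
        refine ⟨cons (x 0) y, ?_, rfl⟩
        intro j hj
        cases j with
        | zero => rfl
        | succ j => exact hy j (by omega)
    rw [h1]
    exact (ih (sh x)).image _ (F_cont _).continuousOn

instance : LocallyConnectedSpace (X m) := by
  rw [locallyConnectedSpace_iff_connected_subsets]
  intro p V hV
  obtain ⟨V', hV', hVo, hp⟩ := mem_nhds_iff.1 hV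
  have h1 : ∀ x : Sq m, ∃ k, q x = p → PiNat.cylinder x k ⊆ q ⁻¹' V' := by
    intro x
    by_cases hx : q x = p
    · obtain ⟨k, hk⟩ := exists_cyl (hVo.preimage q_cont) (show x ∈ q ⁻¹' V' by simpa [hx] using hp)
      exact ⟨k, fun _ => hk⟩
    · exact ⟨0, fun h => absurd h hx⟩
  choose k hk using h1
  let W : Set (Sq m) := ⋃ x ∈ q ⁻¹' {p}, PiNat.cylinder x (k x)
  have hW : IsOpen W := isOpen_biUnion fun x _ => PiNat.isOpen_cylinder _ _ _
  have hc : IsClosedMap (q : Sq m → X m) := q_cont.isClosedMap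
  have ho : IsOpen (q '' Wᶜ)ᶜ := (hc _ hW.isClosed_compl).isOpen_compl
  refine ⟨q '' W, Filter.mem_of_superset (ho.mem_nhds ?_) ?_, ?_, ?_⟩
  · rintro ⟨x, hx, hxp⟩
    exact hx (Set.mem_biUnion (show x ∈ q ⁻¹' {p} from hxp) (PiNat.self_mem_cylinder _ _))
  · intro p' hp'
    obtain ⟨y, rfl⟩ := q_surj p'
    by_contra hy
    exact hp' ⟨y, fun h => hy ⟨y, h, rfl⟩, rfl⟩
  · refine isPreconnected_of_forall p ?_
    rintro _ ⟨y, hy, rfl⟩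
    obtain ⟨x, hx, hxy⟩ := Set.mem_iUnion₂.1 hy
    refine ⟨q '' PiNat.cylinder x (k x), Set.image_mono ?_, ?_, ⟨y, hxy, rfl⟩, cyl_conn _ _⟩
    · exact Set.subset_biUnion_of_mem (u := fun x => PiNat.cylinder x (k x)) hx
    · exact ⟨x, PiNat.self_mem_cylinder _ _, hx⟩
  · rintro _ ⟨y, hy, rfl⟩
    obtain ⟨x, hx, hxy⟩ := Set.mem_iUnion₂.1 hy
    exact hV' (hk x hx hxy)

/-- The part of the dendrite whose sequences leave `x` exactly at time `j`. -/
def Q (x : Sq m) (j : ℕ) : Set (X m) := q '' {y | (∀ t < j, y t = x t) ∧ y j ≠ x j}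

theorem b_mem_Q (x : Sq m) (j : ℕ) : b (pre j x) ∈ Q x j := by
  obtain ⟨i, hi⟩ := exists_ne (x j)
  refine ⟨B (pre j x) i, ⟨fun t ht => B_pre_lt _ _ _ _ ht, ?_⟩, q_B _ _⟩
  rwa [B_pre_eq]

theorem Q_conn (x : Sq m) (j : ℕ) : IsPreconnected (Q x j) := by
  refine isPreconnected_of_forall (b (pre j x)) ?_
  rintro _ ⟨y, ⟨h1, h2⟩, rfl⟩
  refine ⟨q '' PiNat.cylinder y (j + 1), ?_, ⟨B (pre j x) (y j), ?_, q_B _ _⟩,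
    ⟨y, PiNat.self_mem_cylinder _ _, rfl⟩, cyl_conn _ _⟩
  · refine Set.image_mono fun z hz => ⟨fun t ht => ?_, ?_⟩
    · exact (hz t (by omega)).trans (h1 t ht)
    · rw [hz j (by omega)]; exact h2
  · intro t ht
    rcases Nat.lt_succ_iff_lt_or_eq.1 ht with ht | rfl
    · exact (B_pre_lt _ _ _ _ ht).trans (h1 t ht).symm
    · exact B_pre_eq _ _ _

theorem Q_sub {x : Sq m} (hx : ∀ w i, x ≠ B w i) (j : ℕ) : Q x j ⊆ {q x}ᶜ := by
  rintro _ ⟨y, ⟨h1, h2⟩, rfl⟩ h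
  rcases q_eq.1 h with rfl | ⟨w, i, k, -, h3⟩
  · exact h2 rfl
  · exact hx _ _ h3

theorem Q_cover {x y : Sq m} (h : q y ≠ q x) : ∃ j, q y ∈ Q x j := by
  obtain ⟨k, h1, h2⟩ := exists_first (fun h' : y = x => h (by rw [h']))
  exact ⟨k, y, ⟨h1, h2⟩, rfl⟩

/-- The component of the complement of `q x` containing `Q x j`. -/
def comp (x : Sq m) (j : ℕ) : Set (X m) := connectedComponentIn {q x}ᶜ (b (pre j x))

theorem Q_comp {x : Sq m} (hx : ∀ w i, x ≠ B w i) (j : ℕ) : Q x j ⊆ comp x j :=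
  (Q_conn x j).subset_connectedComponentIn (b_mem_Q x j) (Q_sub hx j)

theorem nextIdx {x : Sq m} (hx : ∀ w i, x ≠ B w i) (j : ℕ) :
    ∃ N, j < N ∧ (∀ t, j + t + 1 < N → x (j + t + 1) = aa m t) ∧ comp x N = comp x j := by
  obtain ⟨N, h1, h2⟩ := exists_first (Ne.symm (hx (pre j x) (x j)))
  have hN : j < N := by
    by_contra! h
    rcases Nat.lt_or_eq_of_le h with h | rfl
    · exact h2 (B_pre_lt _ _ _ _ h)
    · exact h2 (B_pre_eq _ _ _)
  refine ⟨N, hN, fun t ht => ?_, ?_⟩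
  · rw [← h1 _ ht, B_pre_gt]
  · have h3 : b (pre j x) ∈ Q x N := ⟨_, ⟨h1, h2⟩, q_B _ _⟩
    exact connectedComponentIn_eq (Q_comp hx N h3)

theorem reach {x : Sq m} (hx : ∀ w i, x ≠ B w i) (j r : ℕ) :
    ∃ j' < j + r + 1, (∀ t, j' + t + 1 < j + r + 1 → x (j' + t + 1) = aa m t) ∧
      comp x j' = comp x j := by
  -- strengthened: the next index after `j'` is at least `j + r + 1`
  suffices h : ∃ j' < j + r + 1, ∃ N ≥ j + r + 1,
      (∀ t, j' + t + 1 < N → x (j' + t + 1) = aa m t) ∧ comp x N = comp x j' ∧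
      comp x j' = comp x j by
    obtain ⟨j', h1, N, h2, h3, -, h5⟩ := h
    exact ⟨j', h1, fun t ht => h3 t (by omega), h5⟩
  induction r with
  | zero =>
    obtain ⟨N, h1, h2, h3⟩ := nextIdx hx j
    exact ⟨j, by omega, N, by omega, h2, h3, rfl⟩
  | succ r ih =>
    obtain ⟨j', h1, N, h2, h3, h4, h5⟩ := ih
    rcases Nat.lt_or_eq_of_le h2 with h | h
    · exact ⟨j', by omega, N, by omega, h3, h4, h5⟩
    · obtain ⟨N', h1', h2', h3'⟩ := nextIdx hx N
      exact ⟨N, by omega, N', by omega, h2', h3', h4.trans h5⟩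

theorem reach' {x : Sq m} (hx : ∀ w i, x ≠ B w i) {j M : ℕ} (hj : j ≤ M) :
    ∃ j', comp x j' = comp x j ∧ (j' = M ∨ (j' < M ∧ x (j' + 1) = 0 ∧
      ∀ t, j' + 1 < t → t ≤ M → x t = 1)) := by
  obtain ⟨j', h1, h2, h3⟩ := reach hx j (M - j)
  refine ⟨j', h3, ?_⟩
  by_cases h : j' = M
  · exact Or.inl h
  · refine Or.inr ⟨by omega, h2 0 (by omega), fun t ht ht' => ?_⟩
    obtain ⟨u, rfl⟩ : ∃ u, t = j' + (u + 1) + 1 := ⟨t - j' - 2, by omega⟩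
    exact h2 (u + 1) (by omega)

theorem three {x : Sq m} (hx : ∀ w i, x ≠ B w i) (j₁ j₂ j₃ : ℕ) :
    comp x j₁ = comp x j₂ ∨ comp x j₁ = comp x j₃ ∨ comp x j₂ = comp x j₃ := by
  obtain ⟨M, hM1, hM2, hM3⟩ : ∃ M, j₁ ≤ M ∧ j₂ ≤ M ∧ j₃ ≤ M :=
    ⟨j₁ + j₂ + j₃, by omega, by omega, by omega⟩
  have key : ∀ u v, (u < M ∧ x (u + 1) = 0 ∧ ∀ t, u + 1 < t → t ≤ M → x t = 1) →
      (v < M ∧ x (v + 1) = 0 ∧ ∀ t, v + 1 < t → t ≤ M → x t = 1) → u = v := by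
    rintro u v ⟨h1, h2, h3⟩ ⟨h1', h2', h3'⟩
    rcases lt_trichotomy u v with h | h | h
    · have := h3 (v + 1) (by omega) (by omega)
      exact absurd (h2'.symm.trans this) zero_ne_one'
    · exact h
    · have := h3' (u + 1) (by omega) (by omega)
      exact absurd (h2.symm.trans this) zero_ne_one'
  obtain ⟨k₁, e1, h1⟩ := reach' hx hM1
  obtain ⟨k₂, e2, h2⟩ := reach' hx hM2
  obtain ⟨k₃, e3, h3⟩ := reach' hx hM3
  rw [← e1, ← e2, ← e3]
  rcases h1 with rfl | h1
  · rcases h2 with rfl | h2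
    · exact Or.inl rfl
    · rcases h3 with rfl | h3
      · exact Or.inr (Or.inl rfl)
      · exact Or.inr (Or.inr (by rw [key _ _ h2 h3]))
  · rcases h2 with rfl | h2
    · rcases h3 with rfl | h3
      · exact Or.inr (Or.inr rfl)
      · exact Or.inr (Or.inl (by rw [key _ _ h1 h3]))
    · exact Or.inl (by rw [key _ _ h1 h2])

theorem comp_aa (j₁ j₂ : ℕ) : comp (aa m) j₁ = comp (aa m) j₂ := by
  have key : ∀ j, j ≤ j₁ + j₂ → comp (aa m) (j₁ + j₂) = comp (aa m) j := by
    intro j hj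
    obtain ⟨k, e, rfl | ⟨-, h, -⟩⟩ := reach' aa_ne_B hj
    · exact e
    · exact absurd h.symm zero_ne_one'
  rw [← key j₁ (by omega), ← key j₂ (by omega)]

theorem e_conn : IsPreconnected ({q (aa m)}ᶜ : Set (X m)) := by
  have h : ({q (aa m)}ᶜ : Set (X m)) = comp (aa m) 0 := by
    refine Set.Subset.antisymm ?_ (connectedComponentIn_subset _ _)
    intro p hp
    obtain ⟨y, rfl⟩ := q_surj p
    obtain ⟨j, hj⟩ := Q_cover hp
    rw [comp_aa 0 j]
    exact Q_comp aa_ne_B j hj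
  rw [h]
  exact isPreconnected_connectedComponentIn

theorem order_nonbranch {x : Sq m} (hx : ∀ w i, x ≠ B w i) :
    ptOrder (X m) (q x) = 1 ∨ ptOrder (X m) (q x) = 2 := by
  have hr : setComponents (X m) {q x}ᶜ = Set.range (comp x) := by
    ext C
    constructor
    · rintro ⟨p, hp, rfl⟩
      obtain ⟨y, rfl⟩ := q_surj p
      obtain ⟨j, hj⟩ := Q_cover hp
      exact ⟨j, connectedComponentIn_eq (Q_comp hx j hj)⟩
    · rintro ⟨j, rfl⟩
      exact ⟨_, Q_sub hx j (b_mem_Q x j), rfl⟩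
  have hfin : (Set.range (comp x)).Finite := by
    by_cases h : ∀ j, comp x j = comp x 0
    · refine (Set.finite_singleton (comp x 0)).subset ?_
      rintro _ ⟨j, rfl⟩
      exact h j
    · push Not at h
      obtain ⟨k, hk⟩ := h
      refine (Set.toFinite {comp x 0, comp x k}).subset ?_
      rintro _ ⟨j, rfl⟩
      rcases three hx j 0 k with h | h | h
      · exact Or.inl h
      · exact Or.inr h
      · exact absurd h.symm hk
  have hle : ¬ 2 < (Set.range (comp x)).ncard := by
    rw [Set.two_lt_ncard_iff hfin]
    rintro ⟨_, _, _, ⟨j₁, rfl⟩, ⟨j₂, rfl⟩, ⟨j₃, rfl⟩, h1, h2, h3⟩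
    rcases three hx j₁ j₂ j₃ with h | h | h
    · exact h1 h
    · exact h2 h
    · exact h3 h
  have hpos : 0 < (Set.range (comp x)).ncard :=
    (Set.ncard_pos hfin).2 (Set.range_nonempty _)
  unfold ptOrder
  rw [hr]
  omega

theorem U_conn (w : List (Fin (m + 3))) (l : Fin (m + 3)) : IsPreconnected (U w l) := by
  induction w generalizing l with
  | nil =>
    have h : U [] l = F l '' ({q (aa m)}ᶜ : Set (X m)) := by
      ext p
      constructor
      · intro hp
        obtain ⟨x, rfl⟩ := q_surj p
        obtain ⟨h1, h2⟩ := mem_U.1 hp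
        refine ⟨q (sh x), ?_, ?_⟩
        · intro h3
          rcases q_eq.1 h3 with h4 | ⟨w, i, j, -, h4⟩
          · apply h1
            rw [← cons_sh x, h4]
            exact q_B [] _
          · exact aa_ne_B _ _ h4
        · rw [F_q, ← show x 0 = l from h2, cons_sh]
      · rintro ⟨p, hp, rfl⟩
        obtain ⟨x, rfl⟩ := q_surj p
        rw [F_q, mem_U]
        exact ⟨ne_nil fun h => hp (by rw [h]; rfl), rfl⟩
    rw [h]
    exact e_conn.image _ (F_cont _).continuousOn
  | cons i w ih =>
    have hF : ∀ x, q (cons i x) ∈ U (i :: w) l ↔ q x ∈ U w l := by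
      intro x
      rw [mem_U, mem_U, s_cons, if_pos rfl, ne_eq, q_cons_eq_b]
      simp
    have hI : IsPreconnected (F i '' U w l) := (ih l).image _ (F_cont _).continuousOn
    have hIs : F i '' U w l ⊆ U (i :: w) l := by
      rintro _ ⟨p, hp, rfl⟩
      obtain ⟨x, rfl⟩ := q_surj p
      exact (hF x).2 hp
    by_cases hl : s w (aa m) = l
    · refine isPreconnected_of_forall (q (cons i (aa m))) fun p hp => ?_
      obtain ⟨x, rfl⟩ := q_surj p
      by_cases h0 : x 0 = i
      · refine ⟨_, hIs, ⟨q (aa m), mem_U.2 ⟨e_ne_b _, hl⟩, rfl⟩, ⟨q (sh x), ?_, ?_⟩, hI⟩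
        · rw [← hF, ← h0, cons_sh]; rwa [h0]
        · rw [F_q, ← h0, cons_sh]
      · refine ⟨Set.range (F (x 0)), ?_, ⟨q (aa m), q_cons_aa _ _⟩, ⟨q (sh x), ?_⟩,
          isPreconnected_range (F_cont _)⟩
        · rintro _ ⟨p, rfl⟩
          obtain ⟨y, rfl⟩ := q_surj p
          rw [F_q, mem_U, s_cons, if_neg h0, ne_eq, q_cons_eq_b]
          exact ⟨fun h => h0 h.1, hl⟩
        · rw [F_q, cons_sh]
    · have h : U (i :: w) l = F i '' U w l := by
        refine Set.Subset.antisymm ?_ hIs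
        intro p hp
        obtain ⟨x, rfl⟩ := q_surj p
        have h0 : x 0 = i := by
          by_contra h0
          rw [← cons_sh x, mem_U, s_cons, if_neg h0] at hp
          exact hl hp.2
        refine ⟨q (sh x), ?_, ?_⟩
        · rw [← hF, ← h0, cons_sh]; rwa [h0]
        · rw [F_q, ← h0, cons_sh]
      rw [h]
      exact hI

theorem U_nonempty (w : List (Fin (m + 3))) (l : Fin (m + 3)) : (U w l).Nonempty := by
  induction w with
  | nil => exact ⟨q (cons l (one m)), mem_U.2 ⟨ne_nil one_ne_aa, rfl⟩⟩
  | cons i w ih =>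
    obtain ⟨p, hp⟩ := ih
    obtain ⟨x, rfl⟩ := q_surj p
    refine ⟨q (cons i x), ?_⟩
    rw [mem_U] at hp
    rw [mem_U, s_cons, if_pos rfl, ne_eq, q_cons_eq_b]
    exact ⟨fun h => hp.1 h.2, hp.2⟩

theorem U_comp (w : List (Fin (m + 3))) {l : Fin (m + 3)} {p : X m} (hp : p ∈ U w l) :
    connectedComponentIn {b w}ᶜ p = U w l := by
  have hsub : U w l ⊆ {b w}ᶜ := fun p h => h.1
  refine Set.Subset.antisymm ?_ ((U_conn w l).subset_connectedComponentIn hp hsub)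
  refine IsPreconnected.subset_left_of_subset_union (U_open w l)
    (isOpen_biUnion (s := {l' | l' ≠ l}) fun l' _ => U_open w l') ?_ ?_ ?_
    isPreconnected_connectedComponentIn
  · rw [Set.disjoint_iUnion₂_right]
    intro l' hl'
    exact U_disj w (Ne.symm hl')
  · intro p' hp'
    have h1 : p' ≠ b w := connectedComponentIn_subset _ _ hp'
    by_cases h : sX w p' = l
    · exact Or.inl ⟨h1, h⟩
    · exact Or.inr (Set.mem_biUnion (show sX w p' ∈ {l' | l' ≠ l} from h) ⟨h1, rfl⟩)
  · exact ⟨p, mem_connectedComponentIn (hsub hp), hp⟩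

theorem order_branch (w : List (Fin (m + 3))) : ptOrder (X m) (b w) = m + 3 := by
  have hr : setComponents (X m) {b w}ᶜ = Set.range (U w) := by
    ext C
    constructor
    · rintro ⟨p, hp, rfl⟩
      exact ⟨sX w p, (U_comp w ⟨hp, rfl⟩).symm⟩
    · rintro ⟨l, rfl⟩
      obtain ⟨p, hp⟩ := U_nonempty w l
      exact ⟨p, hp.1, (U_comp w hp).symm⟩
  have hinj : Function.Injective (U w : Fin (m + 3) → Set (X m)) := by
    intro l l' h
    obtain ⟨p, hp⟩ := U_nonempty w l
    have hp' := hp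
    rw [h] at hp'
    exact hp.2.symm.trans hp'.2
  unfold ptOrder
  rw [hr, ← Set.image_univ, Set.ncard_image_of_injective _ hinj, Set.ncard_univ, Nat.card_fin]

/-- A connected set containing two points contains a branch point between them. -/
theorem mem_between {S : Set (X m)} {p p' : X m} (h : p ≠ p') (hp : p ∈ S) (hp' : p' ∈ S) :
    ∃ w, p ≠ b w ∧ p' ≠ b w ∧ ¬ IsPreconnected (S \ {b w}) := by
  obtain ⟨w, h1, h2, h3⟩ := D_of_ne h
  refine ⟨w, h1, h2, fun hS => ?_⟩
  have h4 := hS.subset_connectedComponentIn (F := {b w}ᶜ) (show p ∈ S \ {b w} from ⟨hp, h1⟩)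
    (fun z hz => hz.2)
  rw [U_comp w (l := sX w p) ⟨h1, rfl⟩] at h4
  exact h3 (h4 (show p' ∈ S \ {b w} from ⟨hp', h2⟩)).2.symm

theorem arc_branch {A : Set (X m)} (e : A ≃ₜ unitInterval) : ∃ p ∈ A, ptOrder (X m) p = m + 3 := by
  have hA : IsPreconnected A := by
    have : ConnectedSpace A := e.symm.surjective.connectedSpace e.symm.continuous
    exact isPreconnected_iff_preconnectedSpace.2 inferInstance
  have hne : ((e.symm 0 : A) : X m) ≠ (e.symm 1 : A) := by
    intro h
    have := e.symm.injective (Subtype.ext h)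
    exact zero_ne_one this
  obtain ⟨w, -, -, h⟩ := mem_between hne (e.symm 0).2 (e.symm 1).2
  refine ⟨b w, ?_, order_branch w⟩
  by_contra hb
  rw [Set.sdiff_singleton_eq_self hb] at h
  exact h hA

theorem circle_conn (z : Circle) : IsPreconnected ({z}ᶜ : Set Circle) := by
  obtain ⟨θ, rfl⟩ := Circle.exp_surjective z
  have h : ({Circle.exp θ}ᶜ : Set Circle) = Circle.exp '' Set.Ioo θ (θ + 2 * Real.pi) := by
    ext y
    constructor
    · intro hy
      obtain ⟨t, rfl⟩ := Circle.exp_surjective y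
      have h1 := toIcoMod_mem_Ico Real.two_pi_pos θ t
      have h2 : Circle.exp (toIcoMod Real.two_pi_pos θ t) = Circle.exp t := by
        rw [toIcoMod]
        exact Circle.periodic_exp.sub_zsmul_eq _
      refine ⟨_, ⟨lt_of_le_of_ne h1.1 ?_, h1.2⟩, h2⟩
      intro h3
      rw [← h3] at h2
      exact hy h2.symm
    · rintro ⟨t, ht, rfl⟩ h
      rw [Set.mem_singleton_iff, Circle.exp_eq_exp] at h
      obtain ⟨k, hk⟩ := h
      have h1 := ht.1
      have h2 := ht.2
      have h3 : (0 : ℝ) < k := by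
        by_contra! h3
        nlinarith [Real.pi_pos]
      have h4 : (k : ℝ) < 1 := by
        by_contra! h4
        nlinarith [Real.pi_pos]
      have h5 : (0 : ℤ) < k := by exact_mod_cast h3
      have h6 : k < (1 : ℤ) := by exact_mod_cast h4
      omega
  rw [h]
  exact isPreconnected_Ioo.image _ Circle.exp.continuous.continuousOn

theorem no_circle (S : Set (X m)) : IsEmpty (S ≃ₜ Circle) := by
  refine ⟨fun e => ?_⟩
  have hne : ((e.symm 1 : S) : X m) ≠ (e.symm (Circle.exp Real.pi) : S) := by
    intro h
    have h1 := e.symm.injective (Subtype.ext h)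
    have h2 := congrArg (fun z : Circle => (z : ℂ)) h1
    simp only [Circle.coe_one, Circle.coe_exp, Complex.exp_pi_mul_I] at h2
    norm_num at h2
  obtain ⟨w, -, -, h⟩ := mem_between hne (e.symm 1).2 (e.symm _).2
  apply h
  by_cases hb : b w ∈ S
  · have h1 : S \ {b w} = (fun z => ((e.symm z : S) : X m)) '' {e ⟨b w, hb⟩}ᶜ := by
      ext p
      constructor
      · rintro ⟨hp, hpb⟩
        refine ⟨e ⟨p, hp⟩, ?_, by simp⟩
        intro h2
        have := e.injective h2
        exact hpb (congrArg Subtype.val this)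
      · rintro ⟨z, hz, rfl⟩
        refine ⟨(e.symm z).2, fun h2 => hz ?_⟩
        have h3 : e.symm z = ⟨b w, hb⟩ := Subtype.ext h2
        rw [← h3]; simp
    rw [h1]
    exact (circle_conn _).image _ (continuous_subtype_val.comp e.symm.continuous).continuousOn
  · rw [Set.sdiff_singleton_eq_self hb]
    have : ConnectedSpace S := e.symm.surjective.connectedSpace e.symm.continuous
    exact isPreconnected_iff_preconnectedSpace.2 inferInstance

theorem main (m : ℕ) : IsWazewskiDendrite (m + 3) (X m) := by
  refine ⟨⟨inferInstance, inferInstance, inferInstance, inferInstance, inferInstance, no_circle⟩,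
    fun p => ?_, fun A ⟨e⟩ => arc_branch e⟩
  obtain ⟨x, rfl⟩ := q_surj p
  by_cases hx : ∀ w i, x ≠ B w i
  · rcases order_nonbranch hx with h | h
    · exact Or.inl h
    · exact Or.inr (Or.inl h)
  · push Not at hx
    obtain ⟨w, i, rfl⟩ := hx
    rw [q_B]
    exact Or.inr (Or.inr (order_branch w))

end Waz

theorem statement0 (n : ℕ) (hn : 3 ≤ n) :
    ∃ (X : Type) (_ : TopologicalSpace X), IsWazewskiDendrite n X := by
  obtain ⟨m, rfl⟩ := Nat.exists_eq_add_of_le' hn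
  exact ⟨Waz.X m, inferInstance, Waz.main m⟩
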